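/- arXiv:1705.04649 — 4 statements merged into one kernel-verified Lean document; each statement's English description precedes it below -/
import Mathlib

section
/- Let M be the 6×6 matrix over ℤ[q] with rows: row 1: (q⁴+q³−q²−q, q³−q, q⁵−2q⁴−q³+2q², q⁵−q³, q⁶−2q⁵−q⁴+2q, −2q⁴−q³+2q²+q); row 2: (q³−q, q⁴+q³−q²−q, q⁵−q³, q⁵−2q⁴−q³+2q², q⁶−2q⁵−q⁴+2q, −2q⁴−q³+2q²+q); row 3: (q³−2q², q³, q⁵+q⁴−3q³+3q², q⁵−3q³, q⁶−2q⁵−3q⁴+4q³, −2q⁴+2q³); row 4: (q³, q³−2q², q⁵−3q³, q⁵+q⁴−3q³+3q², q⁶−2q⁵−3q⁴+4q³, −2q⁴+2q³); row 5: (q³, q³, q⁵−3q³, q⁵−3q³, q⁶−2q⁵−2q⁴+4q³+q², −2q⁴); row 6: (−1, −1, 2q², 2q², −4q²+2, q⁴−2q²+2q+1). For g ≥ 0 set v^g = M^g·(1,0,0,0,0,0)ᵗ and write v^g = (ẽ₀^g, ẽ₁^g, ẽ₂^g, ẽ₃^g, ã^g, b̃^g). Then for every g ≥ 1, the identity 2·ẽ₀^g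 = 2(q³−q)^{2g−1} + 2q(q²−1)^{2g−1} + q(q−1)(q²+q)^{2g−1} + (q−2)(q+1)(q²−q)^{2g−1} holds in ℤ[q]. -/
open Polynomial Matrix

noncomputable section

/-- The indeterminate `q` of `ℤ[q]`. -/
def q : Polynomial ℤ := Polynomial.X

/-- The transition matrix `M` of the genus-adding handle attachment. -/
def M : Matrix (Fin 6) (Fin 6) (Polynomial ℤ) :=
  !![q^4+q^3-q^2-q, q^3-q, q^5-2*q^4-q^3+2*q^2, q^5-q^3, q^6-2*q^5-q^4+2*q, -2*q^4-q^3+2*q^2+q;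
     q^3-q, q^4+q^3-q^2-q, q^5-q^3, q^5-2*q^4-q^3+2*q^2, q^6-2*q^5-q^4+2*q, -2*q^4-q^3+2*q^2+q;
     q^3-2*q^2, q^3, q^5+q^4-3*q^3+3*q^2, q^5-3*q^3, q^6-2*q^5-3*q^4+4*q^3, -2*q^4+2*q^3;
     q^3, q^3-2*q^2, q^5-3*q^3, q^5+q^4-3*q^3+3*q^2, q^6-2*q^5-3*q^4+4*q^3, -2*q^4+2*q^3;
     q^3, q^3, q^5-3*q^3, q^5-3*q^3, q^6-2*q^5-2*q^4+4*q^3+q^2, -2*q^4;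
     -1, -1, 2*q^2, 2*q^2, -4*q^2+2, q^4-2*q^2+2*q+1]

/-- `v g = M^g · (1,0,0,0,0,0)ᵗ`, whose components are
`(ẽ₀^g, ẽ₁^g, ẽ₂^g, ẽ₃^g, ã^g, b̃^g)`. -/
def v (g : ℕ) : Fin 6 → Polynomial ℤ :=
  (M ^ g).mulVec ![1, 0, 0, 0, 0, 0]

/-- An eigenvector of `M` for the eigenvalue `(q³ - q)²`. -/
def eigenvec₁ : Fin 6 → Polynomial ℤ := ![1, 1, 1, 1, 1, 0]

/-- An eigenvector of `M` for the eigenvalue `(q² - 1)²`. -/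
def eigenvec₂ : Fin 6 → Polynomial ℤ := ![q, q, 0, 0, 0, 1]

/-- An eigenvector of `M` for the eigenvalue `(q² + q)²`. -/
def eigenvec₃ : Fin 6 → Polynomial ℤ := ![q * (q - 1), 1 - q, -q, 1, 1, -1]

/-- An eigenvector of `M` for the eigenvalue `(q² - q)²`. -/
def eigenvec₄ : Fin 6 → Polynomial ℤ :=
  ![(q - 2) * (q + 1), -(q + 1), q - 2, -1, -1, -1]

lemma M_mulVec_eigenvec₁ : M *ᵥ eigenvec₁ = (q ^ 3 - q) ^ 2 • eigenvec₁ := by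
  ext1 i
  fin_cases i <;> simp [M, eigenvec₁, Matrix.mulVec, dotProduct, Fin.sum_univ_six] <;> ring

lemma M_mulVec_eigenvec₂ : M *ᵥ eigenvec₂ = (q ^ 2 - 1) ^ 2 • eigenvec₂ := by
  ext1 i
  fin_cases i <;> simp [M, eigenvec₂, Matrix.mulVec, dotProduct, Fin.sum_univ_six] <;> ring

lemma M_mulVec_eigenvec₃ : M *ᵥ eigenvec₃ = (q ^ 2 + q) ^ 2 • eigenvec₃ := by
  ext1 i
  fin_cases i <;> simp [M, eigenvec₃, Matrix.mulVec, dotProduct, Fin.sum_univ_six] <;> ring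

lemma M_mulVec_eigenvec₄ : M *ᵥ eigenvec₄ = (q ^ 2 - q) ^ 2 • eigenvec₄ := by
  ext1 i
  fin_cases i <;> simp [M, eigenvec₄, Matrix.mulVec, dotProduct, Fin.sum_univ_six] <;> ring

lemma v_succ (n : ℕ) : v (n + 1) = M *ᵥ v n := by
  simp [v, pow_succ']

/-- The eigenvector expansion of `2 • v (n + 1)`. -/
lemma two_smul_v_succ (n : ℕ) :
    (2 : Polynomial ℤ) • v (n + 1) =
      (2 * (q ^ 3 - q) ^ (2 * n + 1)) • eigenvec₁ + (2 * (q ^ 2 - 1) ^ (2 * n + 1)) • eigenvec₂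
        + (q ^ 2 + q) ^ (2 * n + 1) • eigenvec₃ + (q ^ 2 - q) ^ (2 * n + 1) • eigenvec₄ := by
  induction n with
  | zero =>
    ext1 i
    fin_cases i <;>
      simp [v, M, eigenvec₁, eigenvec₂, eigenvec₃, eigenvec₄] <;> ring
  | succ n ih =>
    rw [v_succ, ← Matrix.mulVec_smul, ih]
    simp only [Matrix.mulVec_add, Matrix.mulVec_smul, M_mulVec_eigenvec₁, M_mulVec_eigenvec₂,
      M_mulVec_eigenvec₃, M_mulVec_eigenvec₄, smul_smul]
    congr! 4 <;> ring

theorem stmt_0 (g : ℕ) (hg : 1 ≤ g) :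
    2 * v g 0 =
      2*(q^3-q)^(2*g-1) + 2*q*(q^2-1)^(2*g-1)
        + q*(q-1)*(q^2+q)^(2*g-1) + (q-2)*(q+1)*(q^2-q)^(2*g-1) := by
  obtain ⟨n, rfl⟩ := Nat.exists_eq_add_of_le' hg
  have h := congrFun (two_smul_v_succ n) 0
  simp only [Pi.smul_apply, Pi.add_apply, smul_eq_mul, eigenvec₁, eigenvec₂, eigenvec₃,
    eigenvec₄, Matrix.cons_val_zero] at h
  rw [h, show 2 * (n + 1) - 1 = 2 * n + 1 by lia]
  ring
end
end

section
/- Let M be the 6×6 matrix over ℤ[q] with rows: row 1: (q⁴+q³−q²−q, q³−q, q⁵−2q⁴−q³+2q², q⁵−q³, q⁶−2q⁵−q⁴+2q, −2q⁴−q³+2q²+q); row 2: (q³−q, q⁴+q³−q²−q, q⁵−q³, q⁵−2q⁴−q³+2q², q⁶−2q⁵−q⁴+2q, −2q⁴−q³+2q²+q); row 3: (q³−2q², q³, q⁵+q⁴−3q³+3q², q⁵−3q³, q⁶−2q⁵−3q⁴+4q³, −2q⁴+2q³); row 4: (q³, q³−2q², q⁵−3q³, q⁵+q⁴−3q³+3q²,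 q⁶−2q⁵−3q⁴+4q³, −2q⁴+2q³); row 5: (q³, q³, q⁵−3q³, q⁵−3q³, q⁶−2q⁵−2q⁴+4q³+q², −2q⁴); row 6: (−1, −1, 2q², 2q², −4q²+2, q⁴−2q²+2q+1). For g ≥ 0 set v^g = M^g·(1,0,0,0,0,0)ᵗ and write v^g = (ẽ₀^g, ẽ₁^g, ẽ₂^g, ẽ₃^g, ã^g, b̃^g). Then for every g ≥ 1, the identity 2·ẽ₁^g = 2(q³−q)^{2g−1} + 2q(q²−1)^{2g−1} − (q−1)(q²+q)^{2g−1} − (q+1)(q²−q)^{2g−1} holds in ℤ[q]. -/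
open Polynomial Matrix

noncomputable section

theorem v_zero : v 0 = ![1, 0, 0, 0, 0, 0] := by
  simp [v]

theorem v_succ_s1 (g : ℕ) : v (g + 1) = M.mulVec (v g) := by
  simp [v, pow_succ', Matrix.mulVec_mulVec]

/-- Closed forms of the components of `v g`: the coefficients are those of its decomposition into
eigenvectors of `M`, with the common denominator `2 * (q ^ 3 - q)` cleared. -/
theorem v_closed_form (g : ℕ) :
    2*(q^3-q) * v g 0 = 2*((q^3-q)^2)^g + 2*q^2*((q^2-1)^2)^g
      + q*(q-1)^2*((q^2+q)^2)^g + (q-2)*(q+1)^2*((q^2-q)^2)^g ∧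
    2*(q^3-q) * v g 1 = 2*((q^3-q)^2)^g + 2*q^2*((q^2-1)^2)^g
      - (q-1)^2*((q^2+q)^2)^g - (q+1)^2*((q^2-q)^2)^g ∧
    2*(q^3-q) * v g 2 = 2*((q^3-q)^2)^g
      - q*(q-1)*((q^2+q)^2)^g + (q-2)*(q+1)*((q^2-q)^2)^g ∧
    2*(q^3-q) * v g 3 = 2*((q^3-q)^2)^g
      + (q-1)*((q^2+q)^2)^g - (q+1)*((q^2-q)^2)^g ∧
    2*(q^3-q) * v g 4 = 2*((q^3-q)^2)^g
      + (q-1)*((q^2+q)^2)^g - (q+1)*((q^2-q)^2)^g ∧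
    2*(q^3-q) * v g 5 = 2*q*((q^2-1)^2)^g
      - (q-1)*((q^2+q)^2)^g - (q+1)*((q^2-q)^2)^g := by
  induction g with
  | zero =>
    simp only [v_zero, Matrix.cons_val, pow_zero]
    refine ⟨?_, ?_, ?_, ?_, ?_, ?_⟩ <;> ring
  | succ g ih =>
    obtain ⟨h0, h1, h2, h3, h4, h5⟩ := ih
    rw [v_succ_s1]
    simp only [pow_succ _ g]
    generalize ((q^3-q)^2)^g = a at *
    generalize ((q^2-1)^2)^g = b at *
    generalize ((q^2+q)^2)^g = c at *
    generalize ((q^2-q)^2)^g = d at *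
    simp only [Matrix.mulVec, dotProduct, Fin.sum_univ_six, M, Matrix.of_apply, Matrix.cons_val]
    refine ⟨?_, ?_, ?_, ?_, ?_, ?_⟩
    · linear_combination (q^4+q^3-q^2-q)*h0 + (q^3-q)*h1 + (q^5-2*q^4-q^3+2*q^2)*h2 +
        (q^5-q^3)*h3 + (q^6-2*q^5-q^4+2*q)*h4 + (-2*q^4-q^3+2*q^2+q)*h5
    · linear_combination (q^3-q)*h0 + (q^4+q^3-q^2-q)*h1 + (q^5-q^3)*h2 +
        (q^5-2*q^4-q^3+2*q^2)*h3 + (q^6-2*q^5-q^4+2*q)*h4 + (-2*q^4-q^3+2*q^2+q)*h5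
    · linear_combination (q^3-2*q^2)*h0 + (q^3)*h1 + (q^5+q^4-3*q^3+3*q^2)*h2 +
        (q^5-3*q^3)*h3 + (q^6-2*q^5-3*q^4+4*q^3)*h4 + (-2*q^4+2*q^3)*h5
    · linear_combination (q^3)*h0 + (q^3-2*q^2)*h1 + (q^5-3*q^3)*h2 +
        (q^5+q^4-3*q^3+3*q^2)*h3 + (q^6-2*q^5-3*q^4+4*q^3)*h4 + (-2*q^4+2*q^3)*h5
    · linear_combination (q^3)*h0 + (q^3)*h1 + (q^5-3*q^3)*h2 +
        (q^5-3*q^3)*h3 + (q^6-2*q^5-2*q^4+4*q^3+q^2)*h4 + (-2*q^4)*h5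
    · linear_combination (-1)*h0 + (-1)*h1 + (2*q^2)*h2 +
        (2*q^2)*h3 + (-4*q^2+2)*h4 + (q^4-2*q^2+2*q+1)*h5

theorem q_cube_sub_ne_zero : q^3 - q ≠ 0 := by
  intro h
  have := congrArg (Polynomial.eval 2) h
  simp [q] at this

theorem stmt_1 (g : ℕ) (hg : 1 ≤ g) :
    2 * v g 1 =
      2*(q^3-q)^(2*g-1) + 2*q*(q^2-1)^(2*g-1)
        - (q-1)*(q^2+q)^(2*g-1) - (q+1)*(q^2-q)^(2*g-1) := by
  have h := (v_closed_form g).2.1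
  have hpow (x : Polynomial ℤ) : (x^2)^g = x * x^(2*g-1) := by
    rw [← pow_mul, ← pow_succ', Nat.sub_add_cancel (by omega)]
  simp only [hpow] at h
  apply mul_left_cancel₀ q_cube_sub_ne_zero
  linear_combination h
end
end

section
/- Let M be the 6×6 matrix over ℤ[q] with rows: row 1: (q⁴+q³−q²−q, q³−q, q⁵−2q⁴−q³+2q², q⁵−q³, q⁶−2q⁵−q⁴+2q, −2q⁴−q³+2q²+q); row 2: (q³−q, q⁴+q³−q²−q, q⁵−q³, q⁵−2q⁴−q³+2q², q⁶−2q⁵−q⁴+2q, −2q⁴−q³+2q²+q); row 3: (q³−2q², q³, q⁵+q⁴−3q³+3q², q⁵−3q³, q⁶−2q⁵−3q⁴+4q³, −2q⁴+2q³); row 4: (q³, q³−2q², q⁵−3q³, q⁵+q⁴−3q³+3q², q⁶−2q⁵−3q⁴+4q³, −2q⁴+2q³); row 5: (q³, q³, q⁵−3q³, q⁵−3q³, q⁶−2q⁵−2q⁴+4q³+q², −2q⁴); row 6: (−1, −1, 2q², 2q², −4q²+2, q⁴−2q²+2q+1). Let P be the 6×6 matrix over ℤ[q] with rows (−(q²−2q−3),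 −(q+1), −(q−1)², q−1, q, 1), (0, q+1, 0, −(q−1), q, 1), (−(q−3), −1, q−1, −1, 0, 1), (0, 1, 0, 1, 0, 1), (1, 0, −1, 0, 0, 1), (1, 0, 1, 0, 1, 0), and let D = diag((q²−q)², (q²−q)², (q²+q)², (q²+q)², (q²−1)², (q³−q)²). Then M·P = P·D in M₆(ℤ[q]) and det P is a nonzero element of ℤ[q]; in particular M is diagonalizable over the fraction field ℚ(q) with eigenvalues (q²−q)², (q²+q)², (q²−1)², (q³−q)². -/
open Polynomial Matrix

noncomputable section

/-- The matrix `P` of eigenvectors. -/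
def P : Matrix (Fin 6) (Fin 6) (Polynomial ℤ) :=
  !![-(q^2-2*q-3), -(q+1), -(q-1)^2, q-1, q, 1;
     0, q+1, 0, -(q-1), q, 1;
     -(q-3), -1, q-1, -1, 0, 1;
     0, 1, 0, 1, 0, 1;
     1, 0, -1, 0, 0, 1;
     1, 0, 1, 0, 1, 0]

/-- The diagonal matrix `D` of eigenvalues. -/
def D : Matrix (Fin 6) (Fin 6) (Polynomial ℤ) :=
  Matrix.diagonal ![(q^2-q)^2, (q^2-q)^2, (q^2+q)^2, (q^2+q)^2, (q^2-1)^2, (q^3-q)^2]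

/-- The canonical ring homomorphism from `ℤ[q]` to the rational function field `ℚ(q)`. -/
def iQ : Polynomial ℤ →+* RatFunc ℚ :=
  (algebraMap (Polynomial ℚ) (RatFunc ℚ)).comp (Polynomial.mapRingHom (Int.castRingHom ℚ))

/-- The columns of `P` are eigenvectors of `M`. -/
theorem M_mul_P : M * P = P * D := by
  ext1 i j
  rw [D, Matrix.mul_diagonal, Matrix.mul_apply]
  fin_cases i <;> fin_cases j <;>
    simp [M, P, Fin.sum_univ_succ] <;> ring

theorem P_map_eval_two : P.map (Polynomial.evalRingHom 2) =
    !![3, -3, -1, 1, 2, 1;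
       0, 3, 0, -1, 2, 1;
       1, -1, 1, -1, 0, 1;
       0, 1, 0, 1, 0, 1;
       1, 0, -1, 0, 0, 1;
       1, 0, 1, 0, 1, 0] := by
  ext i j
  fin_cases i <;> fin_cases j <;> norm_num [P, q]

theorem det_P_ne_zero : P.det ≠ 0 := by
  intro h
  have h2 := congrArg (Polynomial.evalRingHom 2) h
  rw [RingHom.map_det, RingHom.mapMatrix_apply, P_map_eval_two, map_zero] at h2
  simp [Matrix.det_succ_row_zero, Fin.sum_univ_succ, Fin.succAbove] at h2

theorem iQ_injective : Function.Injective iQ :=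
  (RatFunc.algebraMap_injective ℚ).comp
    (Polynomial.map_injective (Int.castRingHom ℚ) Int.cast_injective)

theorem stmt_6 :
    M * P = P * D ∧ P.det ≠ 0 ∧
      M.map iQ = P.map iQ * D.map iQ * (P.map iQ)⁻¹ := by
  refine ⟨M_mul_P, det_P_ne_zero, ?_⟩
  have hdet : IsUnit (P.map iQ).det := by
    rw [← RingHom.mapMatrix_apply, ← RingHom.map_det, isUnit_iff_ne_zero]
    exact (map_ne_zero_iff iQ iQ_injective).mpr det_P_ne_zero
  rw [← Matrix.map_mul, ← M_mul_P, Matrix.map_mul, Matrix.mul_nonsing_inv_cancel_right _ _ hdet]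
end
end

section
/- Let M be the 6×6 matrix over ℤ[q] with rows: row 1: (q⁴+q³−q²−q, q³−q, q⁵−2q⁴−q³+2q², q⁵−q³, q⁶−2q⁵−q⁴+2q, −2q⁴−q³+2q²+q); row 2: (q³−q, q⁴+q³−q²−q, q⁵−q³, q⁵−2q⁴−q³+2q², q⁶−2q⁵−q⁴+2q, −2q⁴−q³+2q²+q); row 3: (q³−2q², q³, q⁵+q⁴−3q³+3q², q⁵−3q³, q⁶−2q⁵−3q⁴+4q³, −2q⁴+2q³); row 4: (q³, q³−2q², q⁵−3q³, q⁵+q⁴−3q³+3q², q⁶−2q⁵−3q⁴+4q³, −2q⁴+2q³); row 5: (q³, q³, q⁵−3q³, q⁵−3q³, q⁶−2q⁵−2q⁴+4q³+q², −2q⁴); row 6: (−1, −1, 2q², 2q², −4q²+2, q⁴−2q²+2q+1). For g ≥ 0 set v^g = M^g·(1,0,0,0,0,0)ᵗ and write v^g = (ẽ₀^g, ẽ₁^g, ẽ₂^g, ẽ₃^g, ã^g, b̃^g). For g ≥ 1 let m₁^g = (q³−q)^{2g−2} + (q²−1)^{2g−2} − (1/2)((q²+q)^{2g−2} + (q²−q)^{2g−2})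 in ℚ[q]. Then for every g ≥ 1, the identity ẽ₁^g = (q³−q)·m₁^g holds in ℚ[q]. -/
open Polynomial Matrix

noncomputable section

/-- The indeterminate `q` of `ℚ[q]`. -/
def x : Polynomial ℚ := Polynomial.X

/-- `m₁^g`, the E-polynomial of the character variety `M_{-Id}^g`. -/
def m1 (g : ℕ) : Polynomial ℚ :=
  (x^3-x)^(2*g-2) + (x^2-1)^(2*g-2)
    - C (1/2 : ℚ) * ((x^2+x)^(2*g-2) + (x^2-x)^(2*g-2))

/-- Eigenvectors of a matrix are eigenvectors of its powers. -/
lemma pow_mulVec_of_mulVec_eq_smul {n R : Type*} [Fintype n] [DecidableEq n] [CommRing R]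
    {A : Matrix n n R} {w : n → R} {c : R} (h : A *ᵥ w = c • w) (k : ℕ) :
    A ^ k *ᵥ w = c ^ k • w := by
  induction k with
  | zero => simp
  | succ k ih => rw [pow_succ, ← mulVec_mulVec, h, mulVec_smul, ih, smul_smul, pow_succ']

/-- An eigenvector of `M` for the eigenvalue `(q³ - q)²`. -/
def eigvecA : Fin 6 → Polynomial ℤ :=
  ![2*q^3-2*q, 2*q^3-2*q, 2*q^3-2*q, 2*q^3-2*q, 2*q^3-2*q, 0]

/-- An eigenvector of `M` for the eigenvalue `(q² - 1)²`. -/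
def eigvecB : Fin 6 → Polynomial ℤ :=
  ![2*q^3-2*q, 2*q^3-2*q, 0, 0, 0, 2*q^2-2]

/-- An eigenvector of `M` for the eigenvalue `(q² + q)²`. -/
def eigvecC : Fin 6 → Polynomial ℤ :=
  ![q^4-q^2, q-q^3, -q^3-q^2, q^2+q, q^2+q, -q^2-q]

/-- An eigenvector of `M` for the eigenvalue `(q² - q)²`. -/
def eigvecD : Fin 6 → Polynomial ℤ :=
  ![q^4-2*q^3-q^2+2*q, q-q^3, q^3-3*q^2+2*q, q-q^2, q-q^2, q-q^2]

lemma M_mulVec_eigvecA : M *ᵥ eigvecA = ((q^3-q)^2) • eigvecA := by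
  funext i
  fin_cases i <;>
    simp [M, eigvecA, mulVec, dotProduct, Fin.sum_univ_succ] <;> ring

lemma M_mulVec_eigvecB : M *ᵥ eigvecB = ((q^2-1)^2) • eigvecB := by
  funext i
  fin_cases i <;>
    simp [M, eigvecB, mulVec, dotProduct, Fin.sum_univ_succ] <;> ring

lemma M_mulVec_eigvecC : M *ᵥ eigvecC = ((q^2+q)^2) • eigvecC := by
  funext i
  fin_cases i <;>
    simp [M, eigvecC, mulVec, dotProduct, Fin.sum_univ_succ] <;> ring

lemma M_mulVec_eigvecD : M *ᵥ eigvecD = ((q^2-q)^2) • eigvecD := by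
  funext i
  fin_cases i <;>
    simp [M, eigvecD, mulVec, dotProduct, Fin.sum_univ_succ] <;> ring

lemma two_smul_M_mulVec :
    (2 : Polynomial ℤ) • M *ᵥ ![1, 0, 0, 0, 0, 0] = eigvecA + eigvecB + eigvecC + eigvecD := by
  funext i
  fin_cases i <;>
    simp [M, eigvecA, eigvecB, eigvecC, eigvecD] <;> ring

/-- The decomposition of `v` along the eigenvectors of `M`. -/
lemma two_smul_v_succ_s8 (n : ℕ) :
    (2 : Polynomial ℤ) • v (n + 1) =
      ((q^3-q)^2)^n • eigvecA + ((q^2-1)^2)^n • eigvecB + ((q^2+q)^2)^n • eigvecC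
        + ((q^2-q)^2)^n • eigvecD := by
  rw [v, pow_succ, ← mulVec_mulVec, ← mulVec_smul, two_smul_M_mulVec]
  simp only [mulVec_add, pow_mulVec_of_mulVec_eq_smul M_mulVec_eigvecA,
    pow_mulVec_of_mulVec_eq_smul M_mulVec_eigvecB, pow_mulVec_of_mulVec_eq_smul M_mulVec_eigvecC,
    pow_mulVec_of_mulVec_eq_smul M_mulVec_eigvecD]

theorem stmt_8 (g : ℕ) (hg : 1 ≤ g) :
    (v g 1).map (Int.castRingHom ℚ) = (x^3-x) * m1 g := by
  obtain ⟨n, rfl⟩ : ∃ n, g = n + 1 := ⟨g - 1, by omega⟩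
  have h := congrArg (Polynomial.map (Int.castRingHom ℚ)) (congrFun (two_smul_v_succ_s8 n) 1)
  simp [eigvecA, eigvecB, eigvecC, eigvecD, q] at h
  have hC : (2 : Polynomial ℚ) * C (1/2 : ℚ) = 1 := by
    rw [show (2 : Polynomial ℚ) = C 2 from rfl, ← C_mul]
    norm_num
  have hn : 2 * (n + 1) - 2 = 2 * n := by omega
  apply mul_left_cancel₀ (two_ne_zero : (2 : Polynomial ℚ) ≠ 0)
  rw [h, m1, hn, x]
  simp only [pow_mul]
  linear_combination (X^3-X) * (((X^2+X)^2)^n + ((X^2-X)^2)^n) * hC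
end
end
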